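/- arXiv:0810.3731 — 2 statements merged into one kernel-verified Lean document; each statement's English description precedes it below -/
import Mathlib

section
/- Let n, g ∈ ℕ and let B : ℝ^n → (Fin g → Fin n → ℝ) be smooth with components B^α_μ(q). Define R^α_{μν}(q) := ∂B^α_μ/∂q^ν (q) − ∂B^α_ν/∂q^μ (q), the functions p_α(q,p) := Σ_μ B^α_μ(q)·p_μ on ℝ^n × ℝ^n, and the antisymmetric matrix K^{μν}(q,p) := Σ_α R^α_{μν}(q)·p_α(q,p). For smooth f, h : ℝ^n × ℝ^n → ℝ define the bracket ⟦f,h⟧(q,p) = Σ_{μ,ν} K^{μν}(q,p) · (∂f/∂p_μ)(q,p) · (∂h/∂p_ν)(q,p). Then the Jacobi identity ⟦⟦f,h⟧,k⟧ + ⟦⟦h,k⟧,f⟧ + ⟦⟦k,f⟧,h⟧ = 0 holds for all smooth f, h, k if and only if for all (q,p) and all indices ν, σ, λ: Σ_{μ,α,β} (R^α_{νσ}(q)·R^β_{μλ}(q) + R^α_{σλ}(q)·R^β_{μν}(q) + R^α_{λν}(q)·R^β_{μσ}(q)) · B^α_μ(q) · p_β(q,p) = 0. -/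
/-- The partial derivative of `f : ℝ^n → ℝ` in the `l`-th coordinate direction. -/
noncomputable def pd {n : ℕ} (l : Fin n) (f : (Fin n → ℝ) → ℝ) (x : Fin n → ℝ) : ℝ :=
  fderiv ℝ f x (Pi.single l 1)

/-- The partial derivative of `f : ℝ^n × ℝ^n → ℝ` in the `μ`-th momentum direction. -/
noncomputable def pdp {n : ℕ} (μ : Fin n) (f : (Fin n → ℝ) × (Fin n → ℝ) → ℝ)
    (z : (Fin n → ℝ) × (Fin n → ℝ)) : ℝ :=
  fderiv ℝ f z (0, Pi.single μ 1)

/-- The curvature of the Ehresmann connection with coefficients `B^α_μ(q)`: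
`R^α_{μν}(q) = ∂B^α_μ/∂q^ν (q) − ∂B^α_ν/∂q^μ (q)`. -/
noncomputable def curv {n g : ℕ} (B : (Fin n → ℝ) → Fin g → Fin n → ℝ)
    (α : Fin g) (μ ν : Fin n) : (Fin n → ℝ) → ℝ :=
  fun q => pd ν (fun q' => B q' α μ) q - pd μ (fun q' => B q' α ν) q

/-- The constrained momenta `p_α(q,p) = Σ_μ B^α_μ(q) · p_μ`. -/
noncomputable def pconstr {n g : ℕ} (B : (Fin n → ℝ) → Fin g → Fin n → ℝ)
    (α : Fin g) (z : (Fin n → ℝ) × (Fin n → ℝ)) : ℝ :=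
  ∑ μ, B z.1 α μ * z.2 μ

/-- The noncanonical part of the almost Poisson tensor:
`K^{μν}(q,p) = Σ_α R^α_{μν}(q) · p_α(q,p)`. -/
noncomputable def Kten {n g : ℕ} (B : (Fin n → ℝ) → Fin g → Fin n → ℝ)
    (μ ν : Fin n) (z : (Fin n → ℝ) × (Fin n → ℝ)) : ℝ :=
  ∑ α, curv B α μ ν z.1 * pconstr B α z

/-- The bracket `⟦f,h⟧(q,p) = Σ_{μ,ν} K^{μν}(q,p) · ∂f/∂p_μ · ∂h/∂p_ν`. -/
noncomputable def Kbracket {n g : ℕ} (B : (Fin n → ℝ) → Fin g → Fin n → ℝ)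
    (f h : (Fin n → ℝ) × (Fin n → ℝ) → ℝ) : (Fin n → ℝ) × (Fin n → ℝ) → ℝ :=
  fun z => ∑ μ, ∑ ν, Kten B μ ν z * pdp μ f z * pdp ν h z

lemma aux_rot {n : ℕ} (F : Fin n → Fin n → Fin n → ℝ) :
    ∑ a, ∑ b, ∑ l, F a b l = ∑ a, ∑ b, ∑ l, F b l a := by
  calc ∑ a, ∑ b, ∑ l, F a b l = ∑ a, ∑ l, ∑ b, F a b l :=
        Finset.sum_congr rfl fun a _ => Finset.sum_comm
    _ = ∑ l, ∑ a, ∑ b, F a b l := Finset.sum_comm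

lemma aux_D {n : ℕ} (DK : Fin n → Fin n → Fin n → ℝ) (K : Fin n → Fin n → ℝ) (f h k : Fin n → ℝ) :
    ∑ μ, (∑ a, ∑ b, DK a b μ * f a * h b) * (∑ l, K μ l * k l) =
      ∑ a, ∑ b, ∑ l, (∑ μ, DK a b μ * K μ l) * (f a * h b * k l) := by
  rw [aux_rot fun a b l => (∑ μ, DK a b μ * K μ l) * (f a * h b * k l)]
  simp only [Finset.mul_sum]
  rw [Finset.sum_comm]
  refine Finset.sum_congr rfl fun l _ => ?_
  simp only [Finset.sum_mul]
  rw [aux_rot fun a b μ => DK a b μ * K μ l * (f a * h b * k l)]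
  refine Finset.sum_congr rfl fun a _ => Finset.sum_congr rfl fun b _ =>
    Finset.sum_congr rfl fun μ _ => ?_
  ring

lemma aux_Q {n : ℕ} (H : Fin n → Fin n → ℝ) (hH : ∀ a b, H a b = H b a) (u v : Fin n → ℝ) :
    ∑ μ, (∑ a, H a μ * u a) * v μ = ∑ μ, (∑ a, H a μ * v a) * u μ := by
  simp only [Finset.sum_mul]
  rw [Finset.sum_comm]
  refine Finset.sum_congr rfl fun a _ => Finset.sum_congr rfl fun b _ => ?_
  rw [hH]; ring

/-- The momentum derivative of the noncanonical tensor. -/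
noncomputable def DKten {n g : ℕ} (B : (Fin n → ℝ) → Fin g → Fin n → ℝ)
    (a b μ : Fin n) (z : (Fin n → ℝ) × (Fin n → ℝ)) : ℝ :=
  ∑ α, curv B α a b z.1 * B z.1 α μ

lemma contDiff_curv {n g : ℕ} (B : (Fin n → ℝ) → Fin g → Fin n → ℝ)
    (hB : ∀ (α : Fin g) (μ : Fin n), ContDiff ℝ (⊤ : ℕ∞) fun q => B q α μ)
    (α : Fin g) (a b : Fin n) : ContDiff ℝ (⊤ : ℕ∞) (curv B α a b) := by
  unfold curv pd
  exact (((hB α a).fderiv_right (by simp)).clm_apply contDiff_const).sub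
    (((hB α b).fderiv_right (by simp)).clm_apply contDiff_const)

lemma contDiff_Kten {n g : ℕ} (B : (Fin n → ℝ) → Fin g → Fin n → ℝ)
    (hB : ∀ (α : Fin g) (μ : Fin n), ContDiff ℝ (⊤ : ℕ∞) fun q => B q α μ)
    (a b : Fin n) : ContDiff ℝ (⊤ : ℕ∞) (Kten B a b) := by
  unfold Kten pconstr
  refine ContDiff.sum fun α _ => ?_
  refine ((contDiff_curv B hB α a b).comp contDiff_fst).mul ?_
  refine ContDiff.sum fun μ _ => ?_
  exact ((hB α μ).comp contDiff_fst).mul (by fun_prop)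

lemma contDiff_pdp {n : ℕ} {f : (Fin n → ℝ) × (Fin n → ℝ) → ℝ} (hf : ContDiff ℝ (⊤ : ℕ∞) f)
    (a : Fin n) : ContDiff ℝ (⊤ : ℕ∞) (pdp a f) := by
  unfold pdp
  exact (hf.fderiv_right (by simp)).clm_apply contDiff_const

/-- The momentum partial derivative is a one-variable derivative along a line. -/
lemma pdp_eq_of_hasDerivAt {n : ℕ} {f : (Fin n → ℝ) × (Fin n → ℝ) → ℝ} {μ : Fin n}
    {z : (Fin n → ℝ) × (Fin n → ℝ)} (hf : DifferentiableAt ℝ f z) {c : ℝ}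
    (h : HasDerivAt (fun t : ℝ => f (z + t • ((0, Pi.single μ 1) : (Fin n → ℝ) × (Fin n → ℝ)))) c 0) :
    pdp μ f z = c := by
  have h1 : HasLineDerivAt ℝ f (fderiv ℝ f z (0, Pi.single μ 1)) z (0, Pi.single μ 1) :=
    hf.hasFDerivAt.hasLineDerivAt _
  exact HasDerivAt.unique h1 h

lemma pdp_Kten {n g : ℕ} (B : (Fin n → ℝ) → Fin g → Fin n → ℝ)
    (hB : ∀ (α : Fin g) (μ : Fin n), ContDiff ℝ (⊤ : ℕ∞) fun q => B q α μ)
    (a b μ : Fin n) (z : (Fin n → ℝ) × (Fin n → ℝ)) :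
    pdp μ (Kten B a b) z = DKten B a b μ z := by
  refine pdp_eq_of_hasDerivAt ((contDiff_Kten B hB a b).differentiable (by simp) z) ?_
  have key : (fun t : ℝ => Kten B a b (z + t • ((0, Pi.single μ 1) : (Fin n → ℝ) × (Fin n → ℝ)))) =
      fun t => Kten B a b z + t * DKten B a b μ z := by
    funext t
    simp only [Kten, DKten, pconstr, Prod.fst_add, Prod.snd_add, Prod.smul_fst, Prod.smul_snd,
      smul_zero, add_zero, Pi.add_apply, Pi.smul_apply, smul_eq_mul, mul_add,
      Finset.sum_add_distrib, Finset.mul_sum, Pi.single_apply]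
    congr 1
    refine Finset.sum_congr rfl fun α _ => ?_
    simp
    ring
  rw [key]
  simpa using ((hasDerivAt_id (0 : ℝ)).mul_const (DKten B a b μ z)).const_add (Kten B a b z)

lemma Kten_anti {n g : ℕ} (B : (Fin n → ℝ) → Fin g → Fin n → ℝ)
    (a b : Fin n) (z : (Fin n → ℝ) × (Fin n → ℝ)) : Kten B a b z = - Kten B b a z := by
  simp only [Kten, curv, ← Finset.sum_neg_distrib]
  exact Finset.sum_congr rfl fun α _ => by ring

lemma pdp_symm {n : ℕ} {f : (Fin n → ℝ) × (Fin n → ℝ) → ℝ} (hf : ContDiff ℝ (⊤ : ℕ∞) f)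
    (a b : Fin n) (z : (Fin n → ℝ) × (Fin n → ℝ)) :
    pdp b (pdp a f) z = pdp a (pdp b f) z := by
  have hd : DifferentiableAt ℝ (fderiv ℝ f) z :=
    (hf.fderiv_right (m := (⊤ : ℕ∞)) (by simp)).differentiable (by simp) z
  have key : ∀ v w : (Fin n → ℝ) × (Fin n → ℝ),
      fderiv ℝ (fun y => fderiv ℝ f y v) z w = fderiv ℝ (fderiv ℝ f) z w v := by
    intro v w
    rw [fderiv_clm_apply hd (differentiableAt_const v)]
    simp
  have hs : IsSymmSndFDerivAt ℝ f z :=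
    hf.contDiffAt.isSymmSndFDerivAt (by
      simp only [minSmoothness_of_isRCLikeNormedField]
      exact WithTop.coe_le_coe.2 (le_top : (2 : ℕ∞) ≤ ⊤))
  unfold pdp
  rw [key, key]
  exact hs _ _

lemma pdp_Kbracket {n g : ℕ} (B : (Fin n → ℝ) → Fin g → Fin n → ℝ)
    (hB : ∀ (α : Fin g) (μ : Fin n), ContDiff ℝ (⊤ : ℕ∞) fun q => B q α μ)
    {f h : (Fin n → ℝ) × (Fin n → ℝ) → ℝ}
    (hf : ContDiff ℝ (⊤ : ℕ∞) f) (hh : ContDiff ℝ (⊤ : ℕ∞) h)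
    (μ : Fin n) (z : (Fin n → ℝ) × (Fin n → ℝ)) :
    pdp μ (Kbracket B f h) z =
      (∑ a, ∑ b, DKten B a b μ z * pdp a f z * pdp b h z)
      + (∑ a, pdp μ (pdp a f) z * ∑ b, Kten B a b z * pdp b h z)
      - (∑ b, pdp μ (pdp b h) z * ∑ a, Kten B b a z * pdp a f z) := by
  have dK : ∀ a b, HasFDerivAt (Kten B a b) (fderiv ℝ (Kten B a b) z) z := fun a b =>
    ((contDiff_Kten B hB a b).differentiable (by simp) z).hasFDerivAt
  have df : ∀ a, HasFDerivAt (pdp a f) (fderiv ℝ (pdp a f) z) z := fun a =>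
    ((contDiff_pdp hf a).differentiable (by simp) z).hasFDerivAt
  have dh : ∀ a, HasFDerivAt (pdp a h) (fderiv ℝ (pdp a h) z) z := fun a =>
    ((contDiff_pdp hh a).differentiable (by simp) z).hasFDerivAt
  have H : HasFDerivAt (Kbracket B f h) _ z :=
    HasFDerivAt.fun_sum (u := Finset.univ) fun a _ =>
      HasFDerivAt.fun_sum (u := Finset.univ) fun b _ => ((dK a b).mul (df a)).mul (dh b)
  have e : pdp μ (Kbracket B f h) z = ∑ a, ∑ b, (DKten B a b μ z * pdp a f z * pdp b h z
      + pdp μ (pdp a f) z * (Kten B a b z * pdp b h z)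
      + pdp μ (pdp b h) z * (Kten B a b z * pdp a f z)) := by
    conv_lhs => unfold pdp
    rw [H.fderiv]
    simp only [_root_.sum_apply]
    refine Finset.sum_congr rfl fun a _ => Finset.sum_congr rfl fun b _ => ?_
    rw [← pdp_Kten B hB]
    simp only [_root_.add_apply, _root_.smul_apply, smul_eq_mul,
      Pi.mul_apply]
    change _ = fderiv ℝ (Kten B a b) z (0, Pi.single μ 1) * pdp a f z * pdp b h z
      + fderiv ℝ (pdp a f) z (0, Pi.single μ 1) * (Kten B a b z * pdp b h z)
      + fderiv ℝ (pdp b h) z (0, Pi.single μ 1) * (Kten B a b z * pdp a f z)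
    ring
  rw [e]
  simp only [Finset.sum_add_distrib, Finset.mul_sum, sub_eq_add_neg, ← Finset.sum_neg_distrib]
  congr 1
  rw [Finset.sum_comm]
  refine Finset.sum_congr rfl fun b _ => Finset.sum_congr rfl fun a _ => ?_
  rw [Kten_anti B a b]; ring

lemma Kbracket_eq {n g : ℕ} (B : (Fin n → ℝ) → Fin g → Fin n → ℝ)
    (f h : (Fin n → ℝ) × (Fin n → ℝ) → ℝ) (z : (Fin n → ℝ) × (Fin n → ℝ)) :
    Kbracket B f h z = ∑ μ, pdp μ f z * ∑ l, Kten B μ l z * pdp l h z := by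
  simp only [Kbracket, Finset.mul_sum]
  exact Finset.sum_congr rfl fun a _ => Finset.sum_congr rfl fun b _ => by ring

lemma jac_eq {n g : ℕ} (B : (Fin n → ℝ) → Fin g → Fin n → ℝ)
    (hB : ∀ (α : Fin g) (μ : Fin n), ContDiff ℝ (⊤ : ℕ∞) fun q => B q α μ)
    {f h k : (Fin n → ℝ) × (Fin n → ℝ) → ℝ}
    (hf : ContDiff ℝ (⊤ : ℕ∞) f) (hh : ContDiff ℝ (⊤ : ℕ∞) h) (hk : ContDiff ℝ (⊤ : ℕ∞) k)
    (z : (Fin n → ℝ) × (Fin n → ℝ)) :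
    Kbracket B (Kbracket B f h) k z + Kbracket B (Kbracket B h k) f z +
          Kbracket B (Kbracket B k f) h z =
      ∑ a, ∑ b, ∑ l, ((∑ μ, DKten B a b μ z * Kten B μ l z)
        + (∑ μ, DKten B b l μ z * Kten B μ a z) + (∑ μ, DKten B l a μ z * Kten B μ b z))
        * (pdp a f z * pdp b h z * pdp l k z) := by
  rw [Kbracket_eq, Kbracket_eq, Kbracket_eq]
  simp only [pdp_Kbracket B hB hf hh, pdp_Kbracket B hB hh hk, pdp_Kbracket B hB hk hf,
    add_mul, sub_mul, Finset.sum_add_distrib, Finset.sum_sub_distrib]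
  simp only [aux_D (fun a b μ => DKten B a b μ z) (fun a b => Kten B a b z)
    (fun a => pdp a f z) (fun a => pdp a h z) (fun a => pdp a k z),
    aux_D (fun a b μ => DKten B a b μ z) (fun a b => Kten B a b z)
    (fun a => pdp a h z) (fun a => pdp a k z) (fun a => pdp a f z),
    aux_D (fun a b μ => DKten B a b μ z) (fun a b => Kten B a b z)
    (fun a => pdp a k z) (fun a => pdp a f z) (fun a => pdp a h z)]
  have q1 := aux_Q (fun a μ => pdp μ (pdp a f) z) (fun a b => pdp_symm hf a b z)
    (fun a => ∑ b, Kten B a b z * pdp b h z) (fun a => ∑ b, Kten B a b z * pdp b k z)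
  have q2 := aux_Q (fun a μ => pdp μ (pdp a h) z) (fun a b => pdp_symm hh a b z)
    (fun a => ∑ b, Kten B a b z * pdp b k z) (fun a => ∑ b, Kten B a b z * pdp b f z)
  have q3 := aux_Q (fun a μ => pdp μ (pdp a k) z) (fun a b => pdp_symm hk a b z)
    (fun a => ∑ b, Kten B a b z * pdp b f z) (fun a => ∑ b, Kten B a b z * pdp b h z)
  have r2 := aux_rot fun a b l =>
    (∑ μ, DKten B a b μ z * Kten B μ l z) * (pdp a h z * pdp b k z * pdp l f z)
  have r3 := (aux_rot fun b l a =>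
    (∑ μ, DKten B l a μ z * Kten B μ b z) * (pdp l k z * pdp a f z * pdp b h z)).symm
  have r3' := (aux_rot fun a b l =>
    (∑ μ, DKten B a b μ z * Kten B μ l z) * (pdp a k z * pdp b f z * pdp l h z))
  have s2 : ∑ a, ∑ b, ∑ l, (∑ μ, DKten B b l μ z * Kten B μ a z) *
      (pdp b h z * pdp l k z * pdp a f z) = ∑ a, ∑ b, ∑ l, (∑ μ, DKten B b l μ z * Kten B μ a z) *
      (pdp a f z * pdp b h z * pdp l k z) :=
    Finset.sum_congr rfl fun a _ => Finset.sum_congr rfl fun b _ =>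
      Finset.sum_congr rfl fun l _ => by ring
  have s3 : ∑ a, ∑ b, ∑ l, (∑ μ, DKten B l a μ z * Kten B μ b z) *
      (pdp l k z * pdp a f z * pdp b h z) = ∑ a, ∑ b, ∑ l, (∑ μ, DKten B l a μ z * Kten B μ b z) *
      (pdp a f z * pdp b h z * pdp l k z) :=
    Finset.sum_congr rfl fun a _ => Finset.sum_congr rfl fun b _ =>
      Finset.sum_congr rfl fun l _ => by ring
  have r4 := aux_rot fun b l a =>
    (∑ μ, DKten B b l μ z * Kten B μ a z) * (pdp b k z * pdp l f z * pdp a h z)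
  have r5 := aux_rot fun a b l =>
    (∑ μ, DKten B b l μ z * Kten B μ a z) * (pdp b k z * pdp l f z * pdp a h z)
  linarith

lemma J_eq {n g : ℕ} (B : (Fin n → ℝ) → Fin g → Fin n → ℝ)
    (z : (Fin n → ℝ) × (Fin n → ℝ)) (ν σ l : Fin n) :
    ∑ μ, ∑ α, ∑ β,
          (curv B α ν σ z.1 * curv B β μ l z.1 + curv B α σ l z.1 * curv B β μ ν z.1 +
            curv B α l ν z.1 * curv B β μ σ z.1) * B z.1 α μ * pconstr B β z =
      (∑ μ, DKten B ν σ μ z * Kten B μ l z)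
        + (∑ μ, DKten B σ l μ z * Kten B μ ν z) + (∑ μ, DKten B l ν μ z * Kten B μ σ z) := by
  simp only [DKten, Kten, Finset.sum_mul_sum, ← Finset.sum_add_distrib]
  exact Finset.sum_congr rfl fun a _ => Finset.sum_congr rfl fun b _ =>
      Finset.sum_congr rfl fun l _ => by ring

lemma pdp_coord {n : ℕ} (a ν : Fin n) (z : (Fin n → ℝ) × (Fin n → ℝ)) :
    pdp a (fun w => w.2 ν) z = if a = ν then 1 else 0 := by
  refine pdp_eq_of_hasDerivAt (by fun_prop) ?_
  have := ((hasDerivAt_id (0 : ℝ)).mul_const ((Pi.single a 1 : Fin n → ℝ) ν)).const_add (z.2 ν)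
  simpa [Pi.single_apply, eq_comm] using this

/-- The bracket `⟦·,·⟧` built from the curvature of a Chaplygin system's
connection satisfies the Jacobi identity for all smooth functions if and only if
`Σ_{μ,α,β} (R^α_{νσ} R^β_{μλ} + R^α_{σλ} R^β_{μν} + R^α_{λν} R^β_{μσ}) B^α_μ p_β = 0`
for all `(q,p)` and all indices `ν, σ, λ`. -/
theorem chaplygin_bracket_jacobi_iff {n g : ℕ}
    (B : (Fin n → ℝ) → Fin g → Fin n → ℝ)
    (hB : ∀ (α : Fin g) (μ : Fin n), ContDiff ℝ (⊤ : ℕ∞) fun q => B q α μ) :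
    (∀ f h k : (Fin n → ℝ) × (Fin n → ℝ) → ℝ,
        ContDiff ℝ (⊤ : ℕ∞) f → ContDiff ℝ (⊤ : ℕ∞) h → ContDiff ℝ (⊤ : ℕ∞) k →
        ∀ z, Kbracket B (Kbracket B f h) k z + Kbracket B (Kbracket B h k) f z +
          Kbracket B (Kbracket B k f) h z = 0) ↔
      (∀ (z : (Fin n → ℝ) × (Fin n → ℝ)) (ν σ l : Fin n),
        ∑ μ, ∑ α, ∑ β,
          (curv B α ν σ z.1 * curv B β μ l z.1 + curv B α σ l z.1 * curv B β μ ν z.1 +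
            curv B α l ν z.1 * curv B β μ σ z.1) * B z.1 α μ * pconstr B β z = 0) := by
  constructor
  · intro H z ν σ l
    have cd : ∀ i : Fin n, ContDiff ℝ (⊤ : ℕ∞)
        (fun w : (Fin n → ℝ) × (Fin n → ℝ) => w.2 i) := fun i => by fun_prop
    have := H _ _ _ (cd ν) (cd σ) (cd l) z
    rw [jac_eq B hB (cd ν) (cd σ) (cd l)] at this
    rw [J_eq]
    simp only [← J_eq] at this ⊢
    simpa [pdp_coord] using this
  · intro H f h k hf hh hk z
    rw [jac_eq B hB hf hh hk]
    simp only [← J_eq, H, zero_mul, Finset.sum_const_zero]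
end

section
/- Let n ∈ ℕ and let S : Fin n → Fin n → Fin n → ℝ, written S^σ_{μν}, be constants antisymmetric in the lower indices: S^σ_{μν} = −S^σ_{νμ}. Define the linear antisymmetric matrix field K^{μν}(p) := 2·Σ_σ S^σ_{μν}·p_σ on ℝ^n and, for smooth f, h : ℝ^n → ℝ, the bracket ⟦f,h⟧(p) = Σ_{μ,ν} K^{μν}(p)·∂_μ f(p)·∂_ν h(p). Then the Jacobi identity ⟦⟦f,h⟧,k⟧ + ⟦⟦h,k⟧,f⟧ + ⟦⟦k,f⟧,h⟧ = 0 holds for all smooth f, h, k : ℝ^n → ℝ if and only if for all indices τ, ν, ρ, λ: Σ_σ (S^σ_{νρ}·S^τ_{σλ} + S^σ_{ρλ}·S^τ_{σν} + S^σ_{λν}·S^τ_{σρ}) = 0. -/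
/-- The bracket of functions on momentum space associated with an antisymmetric matrix
field `K`: `⟦f,h⟧(p) = Σ_{μ,ν} K p μ ν · ∂_μ f(p) · ∂_ν h(p)`. -/
noncomputable def pbracket {n : ℕ} (K : (Fin n → ℝ) → Fin n → Fin n → ℝ)
    (f h : (Fin n → ℝ) → ℝ) : (Fin n → ℝ) → ℝ :=
  fun p => ∑ μ, ∑ ν, K p μ ν * pd μ f p * pd ν h p

theorem two_le_smooth : (2 : WithTop ℕ∞) ≤ ((⊤ : ℕ∞) : WithTop ℕ∞) := by
  have h : ((2 : ℕ∞) : WithTop ℕ∞) ≤ ((⊤ : ℕ∞) : WithTop ℕ∞) := WithTop.coe_le_coe.2 le_top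
  exact h

theorem pd_smooth {n : ℕ} {f : (Fin n → ℝ) → ℝ} (hf : ContDiff ℝ (⊤ : ℕ∞) f) (a : Fin n) :
    Differentiable ℝ (pd a f) := by
  have h1 : ContDiff ℝ 1 (fderiv ℝ f) := hf.fderiv_right (by rw [one_add_one_eq_two]; exact two_le_smooth)
  have h2 : Differentiable ℝ (fderiv ℝ f) := h1.differentiable (by norm_num)
  exact h2.clm_apply (differentiable_const _)

theorem pd_symm {n : ℕ} {f : (Fin n → ℝ) → ℝ} (hf : ContDiff ℝ (⊤ : ℕ∞) f) (a b : Fin n)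
    (p : Fin n → ℝ) : pd a (pd b f) p = pd b (pd a f) p := by
  have h1 : ContDiff ℝ 1 (fderiv ℝ f) := hf.fderiv_right (by rw [one_add_one_eq_two]; exact two_le_smooth)
  have h2 : Differentiable ℝ (fderiv ℝ f) := h1.differentiable (by norm_num)
  have key : ∀ a b : Fin n, pd a (pd b f) p
      = fderiv ℝ (fderiv ℝ f) p (Pi.single a 1) (Pi.single b 1) := by
    intro a b
    have h3 : HasFDerivAt (pd b f)
        ((fderiv ℝ (fderiv ℝ f) p).flip (Pi.single b 1)) p := by
      have := (h2 p).hasFDerivAt.clm_apply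
        (hasFDerivAt_const (Pi.single b 1 : Fin n → ℝ) p)
      refine this.congr_fderiv ?_
      ext; simp
    unfold pd at h3 ⊢
    rw [h3.fderiv]; rfl
  rw [key, key]
  have hs : IsSymmSndFDerivAt ℝ f p := by
    apply hf.contDiffAt.isSymmSndFDerivAt
    simpa using two_le_smooth
  exact hs _ _

theorem pd_bracket {n : ℕ} (S : Fin n → Fin n → Fin n → ℝ) {f h : (Fin n → ℝ) → ℝ}
    (hf : ContDiff ℝ (⊤ : ℕ∞) f) (hh : ContDiff ℝ (⊤ : ℕ∞) h) (m : Fin n) (p : Fin n → ℝ) :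
    pd m (pbracket (fun p' μ ν => 2 * ∑ σ, S σ μ ν * p' σ) f h) p =
      ∑ a, ∑ b, (2 * S m a b * pd a f p * pd b h p
        + (2 * ∑ σ, S σ a b * p σ) * pd m (pd a f) p * pd b h p
        + (2 * ∑ σ, S σ a b * p σ) * pd a f p * pd m (pd b h) p) := by
  have hK : ∀ a b : Fin n, HasFDerivAt (fun p' : Fin n → ℝ => 2 * ∑ σ, S σ a b * p' σ)
      ((2 : ℝ) • ∑ σ, S σ a b • (ContinuousLinearMap.proj σ : (Fin n → ℝ) →L[ℝ] ℝ)) p := by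
    intro a b
    refine HasFDerivAt.const_mul ?_ _
    refine HasFDerivAt.fun_sum fun σ _ => ?_
    exact (ContinuousLinearMap.proj σ : (Fin n → ℝ) →L[ℝ] ℝ).hasFDerivAt.const_mul _
  have H : HasFDerivAt (pbracket (fun p' μ ν => 2 * ∑ σ, S σ μ ν * p' σ) f h) _ p :=
    HasFDerivAt.fun_sum fun a _ => HasFDerivAt.fun_sum fun b _ =>
      ((hK a b).mul (pd_smooth hf a p).hasFDerivAt).mul (pd_smooth hh b p).hasFDerivAt
  rw [pd, H.fderiv]
  simp only [_root_.sum_apply, _root_.add_apply,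
    _root_.smul_apply, ContinuousLinearMap.proj_apply, smul_eq_mul]
  refine Finset.sum_congr rfl fun a _ => Finset.sum_congr rfl fun b _ => ?_
  have : ∑ σ, S σ a b * (Pi.single m (1 : ℝ) : Fin n → ℝ) σ = S m a b := by
    simp [Pi.single_apply]
  rw [this]
  have q : ∀ g : (Fin n → ℝ) → ℝ, fderiv ℝ g p (Pi.single m 1) = pd m g p := fun _ => rfl
  simp only [q, Pi.mul_apply]
  ring

/-- The second-order contraction. -/
noncomputable def TT {n : ℕ} (K F : Fin n → Fin n → ℝ) (u v : Fin n → ℝ) : ℝ :=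
  ∑ m, ∑ a, F m a * (∑ b, K a b * u b) * (∑ c, K m c * v c)

theorem TT_symm {n : ℕ} (K F : Fin n → Fin n → ℝ) (hF : ∀ a b, F a b = F b a)
    (u v : Fin n → ℝ) : TT K F u v = TT K F v u := by
  unfold TT
  rw [Finset.sum_comm]
  refine Finset.sum_congr rfl fun a _ => Finset.sum_congr rfl fun b _ => ?_
  rw [hF]; ring

theorem perm4 {n : ℕ} (X : Fin n → Fin n → Fin n → Fin n → ℝ) :
    ∑ a, ∑ b, ∑ c, ∑ m, X a b c m = ∑ m, ∑ c, ∑ a, ∑ b, X a b c m := by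
  have h1 : ∀ Y : Fin n → Fin n → Fin n → ℝ,
      ∑ a, ∑ b, ∑ c, Y a b c = ∑ c, ∑ a, ∑ b, Y a b c := by
    intro Y
    have : ∀ a, ∑ b, ∑ c, Y a b c = ∑ c, ∑ b, Y a b c := fun a => Finset.sum_comm
    simp only [this]
    exact Finset.sum_comm
  rw [h1 fun a b c => ∑ m, X a b c m]
  have : ∀ c, ∑ a, ∑ b, ∑ m, X a b c m = ∑ m, ∑ a, ∑ b, X a b c m :=
    fun c => h1 fun a b m => X a b c m
  simp only [this]
  exact Finset.sum_comm

theorem dbl {n : ℕ} (S : Fin n → Fin n → Fin n → ℝ)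
    (hS : ∀ σ μ ν : Fin n, S σ μ ν = - S σ ν μ) {f h k : (Fin n → ℝ) → ℝ}
    (hf : ContDiff ℝ (⊤ : ℕ∞) f) (hh : ContDiff ℝ (⊤ : ℕ∞) h) (p : Fin n → ℝ) :
    pbracket (fun p' μ ν => 2 * ∑ σ, S σ μ ν * p' σ)
      (pbracket (fun p' μ ν => 2 * ∑ σ, S σ μ ν * p' σ) f h) k p =
    (∑ a, ∑ b, ∑ c, pd a f p * pd b h p * pd c k p *
      (4 * ∑ τ, p τ * ∑ σ, S σ a b * S τ σ c))
    + TT (fun μ ν => 2 * ∑ σ, S σ μ ν * p σ) (fun m a => pd m (pd a f) p)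
        (fun b => pd b h p) (fun c => pd c k p)
    - TT (fun μ ν => 2 * ∑ σ, S σ μ ν * p σ) (fun m a => pd m (pd a h) p)
        (fun b => pd b f p) (fun c => pd c k p) := by
  have hK : ∀ a b, (2 * ∑ σ, S σ a b * p σ) = - (2 * ∑ σ, S σ b a * p σ) := by
    intro a b
    rw [← mul_neg, ← Finset.sum_neg_distrib]
    congr 1
    refine Finset.sum_congr rfl fun σ _ => ?_
    rw [hS]; ring
  have e1 : ∀ a b c, (4 * ∑ τ, p τ * ∑ σ, S σ a b * S τ σ c)
      = ∑ m, 2 * S m a b * (2 * ∑ σ, S σ m c * p σ) := by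
    intro a b c
    simp only [Finset.mul_sum]
    rw [Finset.sum_comm]
    refine Finset.sum_congr rfl fun _ _ => Finset.sum_congr rfl fun _ _ => ?_
    ring
  simp only [e1]
  unfold pbracket
  have := fun m => pd_bracket S hf hh m p
  unfold pbracket at this
  simp only [this]
  generalize hKK : (fun a b => 2 * ∑ σ, S σ a b * p σ) = K at *
  have hKa : ∀ a b, 2 * ∑ σ, S σ a b * p σ = K a b := fun a b => by rw [← hKK]
  simp only [hKa] at *
  clear this e1 hKK hKa
  have t1 : TT K (fun m a => pd m (pd a f) p) (fun b => pd b h p) (fun c => pd c k p)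
     = ∑ m, ∑ c, ∑ a, ∑ b, K m c * (K a b * pd m (pd a f) p * pd b h p) * pd c k p := by
    unfold TT
    refine Finset.sum_congr rfl fun m _ => ?_
    rw [Finset.sum_comm]
    refine Finset.sum_congr rfl fun a _ => ?_
    simp only [Finset.mul_sum, Finset.sum_mul]
    refine Finset.sum_congr rfl fun _ _ => Finset.sum_congr rfl fun _ _ => ?_
    ring
  have t2 : TT K (fun m a => pd m (pd a h) p) (fun b => pd b f p) (fun c => pd c k p)
     = - ∑ m, ∑ c, ∑ a, ∑ b, K m c * (K a b * pd a f p * pd m (pd b h) p) * pd c k p := by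
    unfold TT
    rw [← Finset.sum_neg_distrib]
    refine Finset.sum_congr rfl fun m _ => ?_
    have : ∀ c, ∑ a, ∑ b, K m c * (K a b * pd a f p * pd m (pd b h) p) * pd c k p
        = ∑ b, ∑ a, K m c * (K a b * pd a f p * pd m (pd b h) p) * pd c k p :=
      fun c => Finset.sum_comm
    simp only [this]
    rw [Finset.sum_comm, ← Finset.sum_neg_distrib]
    refine Finset.sum_congr rfl fun a _ => ?_
    simp only [Finset.mul_sum, Finset.sum_mul, ← Finset.sum_neg_distrib]
    refine Finset.sum_congr rfl fun c _ => Finset.sum_congr rfl fun b _ => ?_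
    rw [hK a b]
    ring
  have t3 : ∑ a, ∑ b, ∑ c, pd a f p * pd b h p * pd c k p * ∑ m, 2 * S m a b * K m c
     = ∑ m, ∑ c, ∑ a, ∑ b, K m c * (2 * S m a b * pd a f p * pd b h p) * pd c k p := by
    simp only [Finset.mul_sum]
    rw [perm4]
    refine Finset.sum_congr rfl fun c _ => Finset.sum_congr rfl fun b _ =>
      Finset.sum_congr rfl fun _ _ => Finset.sum_congr rfl fun _ _ => ?_
    ring
  rw [t1, t2, t3, sub_neg_eq_add]
  simp only [← Finset.sum_add_distrib, Finset.mul_sum, Finset.sum_mul]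
  refine Finset.sum_congr rfl fun c _ => Finset.sum_congr rfl fun b _ =>
      Finset.sum_congr rfl fun _ _ => Finset.sum_congr rfl fun _ _ => ?_
  ring

theorem jac_formula {n : ℕ} (S : Fin n → Fin n → Fin n → ℝ)
    (hS : ∀ σ μ ν : Fin n, S σ μ ν = - S σ ν μ) {f h k : (Fin n → ℝ) → ℝ}
    (hf : ContDiff ℝ (⊤ : ℕ∞) f) (hh : ContDiff ℝ (⊤ : ℕ∞) h)
    (hk : ContDiff ℝ (⊤ : ℕ∞) k) (p : Fin n → ℝ) :
    pbracket (fun p' μ ν => 2 * ∑ σ, S σ μ ν * p' σ)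
        (pbracket (fun p' μ ν => 2 * ∑ σ, S σ μ ν * p' σ) f h) k p +
      pbracket (fun p' μ ν => 2 * ∑ σ, S σ μ ν * p' σ)
        (pbracket (fun p' μ ν => 2 * ∑ σ, S σ μ ν * p' σ) h k) f p +
      pbracket (fun p' μ ν => 2 * ∑ σ, S σ μ ν * p' σ)
        (pbracket (fun p' μ ν => 2 * ∑ σ, S σ μ ν * p' σ) k f) h p =
    ∑ a, ∑ b, ∑ c, pd a f p * pd b h p * pd c k p *
      (4 * ∑ τ, p τ * ∑ σ, (S σ a b * S τ σ c + S σ b c * S τ σ a + S σ c a * S τ σ b)) := by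
  rw [dbl S hS hf hh, dbl S hS hh hk, dbl S hS hk hf]
  rw [TT_symm _ (fun m a => pd m (pd a f) p) (fun a b => pd_symm hf a b p) (fun b => pd b h p),
    TT_symm _ (fun m a => pd m (pd a h) p) (fun a b => pd_symm hh a b p) (fun b => pd b k p),
    TT_symm _ (fun m a => pd m (pd a k) p) (fun a b => pd_symm hk a b p) (fun b => pd b f p)]
  have r1 : ∀ X : Fin n → Fin n → Fin n → ℝ, ∑ b, ∑ c, ∑ a, X b c a
      = ∑ a, ∑ b, ∑ c, X b c a := by
    intro X
    have : ∀ b, ∑ c, ∑ a, X b c a = ∑ a, ∑ c, X b c a := fun b => Finset.sum_comm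
    simp only [this]
    exact Finset.sum_comm
  have e2 := r1 fun b c a => pd b h p * pd c k p * pd a f p *
      (4 * ∑ τ, p τ * ∑ σ, S σ b c * S τ σ a)
  have e3 := (r1 fun a b c => pd c k p * pd a f p * pd b h p *
      (4 * ∑ τ, p τ * ∑ σ, S σ c a * S τ σ b)).symm
  rw [e2, e3]
  have e4 : ∑ a, ∑ b, ∑ c, pd a f p * pd b h p * pd c k p *
      (4 * ∑ τ, p τ * ∑ σ, (S σ a b * S τ σ c + S σ b c * S τ σ a + S σ c a * S τ σ b))
     = ∑ a, ∑ b, ∑ c, pd a f p * pd b h p * pd c k p *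
        (4 * ∑ τ, p τ * ∑ σ, S σ a b * S τ σ c)
      + ∑ a, ∑ b, ∑ c, pd b h p * pd c k p * pd a f p *
        (4 * ∑ τ, p τ * ∑ σ, S σ b c * S τ σ a)
      + ∑ a, ∑ b, ∑ c, pd c k p * pd a f p * pd b h p *
        (4 * ∑ τ, p τ * ∑ σ, S σ c a * S τ σ b) := by
    simp only [← Finset.sum_add_distrib]
    refine Finset.sum_congr rfl fun a _ => Finset.sum_congr rfl fun b _ =>
      Finset.sum_congr rfl fun c _ => ?_
    simp only [Finset.sum_add_distrib, mul_add]
    ring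
  rw [e4]
  ring

/-- For constant torsion components `S^σ_{μν}` antisymmetric in the lower
indices, with `K^{μν}(p) = 2 Σ_σ S^σ_{μν} p_σ`, the associated bracket on `ℝ^n`
satisfies the Jacobi identity for all smooth functions if and only if `S` satisfies the
Lie-algebra Jacobi condition
`Σ_σ (S^σ_{νρ} S^τ_{σλ} + S^σ_{ρλ} S^τ_{σν} + S^σ_{λν} S^τ_{σρ}) = 0`. -/
theorem torsion_bracket_jacobi_iff_structure_constants {n : ℕ}
    (S : Fin n → Fin n → Fin n → ℝ)
    (hSanti : ∀ σ μ ν : Fin n, S σ μ ν = - S σ ν μ) :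
    (∀ f h k : (Fin n → ℝ) → ℝ,
        ContDiff ℝ (⊤ : ℕ∞) f → ContDiff ℝ (⊤ : ℕ∞) h → ContDiff ℝ (⊤ : ℕ∞) k →
        ∀ p : Fin n → ℝ,
          pbracket (fun p' μ ν => 2 * ∑ σ, S σ μ ν * p' σ)
              (pbracket (fun p' μ ν => 2 * ∑ σ, S σ μ ν * p' σ) f h) k p +
            pbracket (fun p' μ ν => 2 * ∑ σ, S σ μ ν * p' σ)
              (pbracket (fun p' μ ν => 2 * ∑ σ, S σ μ ν * p' σ) h k) f p +
            pbracket (fun p' μ ν => 2 * ∑ σ, S σ μ ν * p' σ)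
              (pbracket (fun p' μ ν => 2 * ∑ σ, S σ μ ν * p' σ) k f) h p = 0) ↔
      (∀ τ ν ρ l : Fin n,
        ∑ σ, (S σ ν ρ * S τ σ l + S σ ρ l * S τ σ ν + S σ l ν * S τ σ ρ) = 0) := by
  constructor
  · intro H τ a b c
    have hc : ∀ i : Fin n, ContDiff ℝ (⊤ : ℕ∞) (fun x : Fin n → ℝ => x i) :=
      fun i => contDiff_apply ℝ ℝ i
    have hpd : ∀ (i j : Fin n) (p : Fin n → ℝ),
        pd j (fun x : Fin n → ℝ => x i) p = if j = i then 1 else 0 := by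
      intro i j p
      have : HasFDerivAt (fun x : Fin n → ℝ => x i)
          (ContinuousLinearMap.proj i : (Fin n → ℝ) →L[ℝ] ℝ) p := hasFDerivAt_apply i p
      rw [pd, this.fderiv]
      simp [Pi.single_apply, eq_comm]
    have := H _ _ _ (hc a) (hc b) (hc c) (Pi.single τ 1)
    rw [jac_formula S hSanti (hc a) (hc b) (hc c)] at this
    simp only [hpd] at this
    simpa [Pi.single_apply, ite_mul, mul_ite] using this
  · intro H f h k hf hh hk p
    rw [jac_formula S hSanti hf hh hk]
    simp [H]
end
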